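/- (Discrete Hardy–Littlewood–Sobolev inequality.) Let d ≥ 1, 0 < α < d, and 1 < r, t < ∞ with 1/r + 1/t + (d−α)/d = 2. Then there exists a constant C = C(r,t,α,d) > 0 such that for all u ∈ ℓ^r(ℤ^d) and v ∈ ℓ^t(ℤ^d), ∑_{x∈ℤ^d}∑_{y∈ℤ^d} R_α(x,y)·|u(y)|·|v(x)| ≤ C‖u‖_r‖v‖_t. -/

import Mathlib

open MeasureTheory Filter Topology
open scoped ENNReal

noncomputable section

namespace DiscreteChoquard

variable {d : ℕ}

/-- The lattice `ℤ^d`. -/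
abbrev Z (d : ℕ) := Fin d → ℤ

/-- Graph distance on `ℤ^d`, as a real number. -/
def latDist (x y : Z d) : ℝ := ∑ i, |((x i - y i : ℤ) : ℝ)|

/-- The kernel hypotheses on `W_s`: symmetry, positivity, and the two-sided bound
`c|x−y|^{−d−2s} ≤ W_s(x,y) ≤ C|x−y|^{−d−2s}` for `x ≠ y`. -/
def KernelOK (d : ℕ) (s : ℝ) (W : Z d → Z d → ℝ) : Prop :=
  (∀ x y, W x y = W y x) ∧ (∀ x y, 0 < W x y) ∧
  ∃ c C : ℝ, 0 < c ∧ c ≤ C ∧ ∀ x y : Z d, x ≠ y →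
    c * latDist x y ^ (-(d : ℝ) - 2 * s) ≤ W x y ∧
      W x y ≤ C * latDist x y ^ (-(d : ℝ) - 2 * s)

/-- The fractional gradient form `∇^s u ∇^s v (x)`.  (The `y = x` summand vanishes, so we
sum over all `y`.) -/
def gradForm (W : Z d → Z d → ℝ) (u v : Z d → ℝ) (x : Z d) : ℝ :=
  (1 / 2) * ∑' y : Z d, W x y * (u x - u y) * (v x - v y)

/-- `|∇^s u|(x)`. -/
def gradNorm (W : Z d → Z d → ℝ) (u : Z d → ℝ) (x : Z d) : ℝ :=
  Real.sqrt ((1 / 2) * ∑' y : Z d, W x y * (u x - u y) ^ 2)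

/-- The fractional `p`-Laplacian `(−Δ)_p^s u (x)`. -/
def pLap (W : Z d → Z d → ℝ) (p : ℝ) (u : Z d → ℝ) (x : Z d) : ℝ :=
  (1 / 2) * ∑' y : Z d,
    W x y * (gradNorm W u x ^ (p - 2) + gradNorm W u y ^ (p - 2)) * (u x - u y)

/-- `‖u‖_{H_{s,p}}^p = ∑_x (|∇^s u|^p(x) + h(x)|u(x)|^p)`. -/
def HnormP (W : Z d → Z d → ℝ) (h : Z d → ℝ) (p : ℝ) (u : Z d → ℝ) : ℝ :=
  ∑' x : Z d, (gradNorm W u x ^ p + h x * |u x| ^ p)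

/-- `‖u‖_{H_{s,p}}`. -/
def normH (W : Z d → Z d → ℝ) (h : Z d → ℝ) (p : ℝ) (u : Z d → ℝ) : ℝ :=
  HnormP W h p u ^ (1 / p)

/-- Membership `u ∈ H_{s,p}`, i.e. `‖u‖_{H_{s,p}} < ∞` (all the defining series converge). -/
def memH (W : Z d → Z d → ℝ) (h : Z d → ℝ) (p : ℝ) (u : Z d → ℝ) : Prop :=
  (∀ x : Z d, Summable fun y : Z d => W x y * (u x - u y) ^ 2) ∧
  Summable fun x : Z d => gradNorm W u x ^ p + h x * |u x| ^ p

/-- The `ℓ^q` norm on `ℤ^d`. -/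
def lnorm (q : ℝ) (u : Z d → ℝ) : ℝ := (∑' x : Z d, |u x| ^ q) ^ (1 / q)

/-- The torus box `[0, 2π]^d`. -/
def box (d : ℕ) : Set (Fin d → ℝ) := Set.univ.pi fun _ => Set.Icc 0 (2 * Real.pi)

/-- `μ(k) = 2d − 2 ∑_j cos k_j`. -/
def muk (d : ℕ) (k : Fin d → ℝ) : ℝ := 2 * d - 2 * ∑ j, Real.cos (k j)

/-- The fractional degree `K_α = (2π)^{-d} ∫_{[0,2π]^d} μ(k)^{α/2} dk`. -/
def Kfrac (d : ℕ) (α : ℝ) : ℝ :=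
  (2 * Real.pi) ^ (-(d : ℝ)) * ∫ k in box d, muk d k ^ (α / 2)

/-- The Green's function `R_α(x,y)` of the discrete fractional Laplacian. -/
def Riesz (d : ℕ) (α : ℝ) (x y : Z d) : ℝ :=
  Kfrac d α * (2 * Real.pi) ^ (-(d : ℝ)) *
    ∫ k in box d, Real.cos (∑ j, ((x j - y j : ℤ) : ℝ) * k j) * muk d k ^ (-(α / 2))

/-- The convolution `(R_α ∗ v)(x) = ∑_y R_α(x,y) v(y)`. -/
def conv (d : ℕ) (α : ℝ) (v : Z d → ℝ) (x : Z d) : ℝ := ∑' y : Z d, Riesz d α x y * v y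

/-- `F(t) = ∫_0^t f(r) dr`. -/
def Fint (f : ℝ → ℝ) (t : ℝ) : ℝ := ∫ r in (0 : ℝ)..t, f r

/-- Positive part `u⁺ = max(u,0)`. -/
def pos (u : Z d → ℝ) (x : Z d) : ℝ := max (u x) 0

/-- Negative part `u⁻ = min(u,0)`. -/
def negp (u : Z d → ℝ) (x : Z d) : ℝ := min (u x) 0

/-- Hypothesis (h2): `h(x) → ∞` as `|x| → ∞`. -/
def H2 (h : Z d → ℝ) : Prop := Tendsto h cofinite atTop

/-- Hypothesis (f1): `f(t) = o(t^{p−1})` as `t → 0⁺`. -/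
def F1 (f : ℝ → ℝ) (p : ℝ) : Prop :=
  ∀ ε > (0 : ℝ), ∃ δ > (0 : ℝ), ∀ t : ℝ, 0 < t → t < δ → |f t| ≤ ε * t ^ (p - 1)

/-- Hypothesis (f3): `0 ≤ θ F(t) ≤ 2 f(t) t` for `t > 0`. -/
def F3 (f : ℝ → ℝ) (θ : ℝ) : Prop :=
  ∀ t > (0 : ℝ), 0 ≤ θ * Fint f t ∧ θ * Fint f t ≤ 2 * f t * t

/-- The energy functional `J̃`. -/
def energy (W : Z d → Z d → ℝ) (h : Z d → ℝ) (p α : ℝ) (f : ℝ → ℝ) (u : Z d → ℝ) : ℝ :=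
  (1 / p) * HnormP W h p u -
    (1 / 2) * ∑' x : Z d, conv d α (fun y => Fint f (pos u y)) x * Fint f (pos u x)

/-- The Nehari set `M`. -/
def Nehari (W : Z d → Z d → ℝ) (h : Z d → ℝ) (p α : ℝ) (f : ℝ → ℝ) : Set (Z d → ℝ) :=
  {u | memH W h p u ∧ u ≠ 0 ∧
    HnormP W h p u =
      ∑' x : Z d, conv d α (fun y => Fint f (pos u y)) x * f (pos u x) * pos u x}

/-- Hypothesis (f4). -/
def F4 (W : Z d → Z d → ℝ) (h : Z d → ℝ) (p α : ℝ) (f : ℝ → ℝ) : Prop :=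
  ∀ u : Z d → ℝ, memH W h p u → pos u ≠ 0 →
    StrictMonoOn (fun t : ℝ =>
      t ^ (1 - p) *
        ∑' x : Z d, conv d α (fun y => Fint f (t * pos u y)) x * f (t * pos u x) * pos u x)
      (Set.Ioi 0)

/-- The derivative pairing `⟨J̃′(u), φ⟩`. -/
def pairing (W : Z d → Z d → ℝ) (h : Z d → ℝ) (p α : ℝ) (f : ℝ → ℝ) (u φ : Z d → ℝ) : ℝ :=
  (∑' x : Z d,
      (gradNorm W u x ^ (p - 2) * gradForm W u φ x + h x * |u x| ^ (p - 2) * u x * φ x)) -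
    ∑' x : Z d, conv d α (fun y => Fint f (pos u y)) x * f (pos u x) * φ x

lemma hls_partial_sum {ι : Type*} [Countable ι] (K : ι → ℝ≥0∞) (C : ℝ≥0∞) (θ : ℝ) (hθ : 0 < θ)
    (hK : ∀ F : Finset ι, ∑ x ∈ F, K x ≤ C * ENNReal.ofReal ((F.card : ℝ) ^ θ))
    (w : ι → ℝ) (hw : ∀ x, 0 ≤ w x) (t : ℝ) (ht : 0 < t) (htθ : t * θ < 1) (B : ℝ)
    (hB : HasSum (fun x => w x ^ t) B) (M : ℝ) (hM : 0 < M) :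
    ∑' x, (if w x ≤ M then K x * ENNReal.ofReal (w x) else 0) ≤
      C * ENNReal.ofReal (B ^ θ * (M ^ (1 - t * θ) / (1 - t * θ))) := by
  have hB0 : 0 ≤ B := hB.nonneg (fun x => Real.rpow_nonneg (hw x) _)
  have h1 : ∀ b : ℝ, 0 < b → ∑' x, K x * (if b < w x then 1 else 0) ≤
      C * ENNReal.ofReal (B ^ θ * b ^ (-(t * θ))) := by
    intro b hb
    rw [ENNReal.tsum_eq_iSup_sum]
    refine iSup_le fun s => ?_
    have e1 : ∑ x ∈ s, K x * (if b < w x then 1 else 0) = ∑ x ∈ s.filter (fun x => b < w x), K x := by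
      rw [Finset.sum_filter]
      refine Finset.sum_congr rfl fun x _ => ?_
      split_ifs <;> simp
    rw [e1]
    refine (hK _).trans ?_
    gcongr
    set n := (s.filter (fun x => b < w x)).card
    have h2 : (n : ℝ) * b ^ t ≤ B := by
      calc (n : ℝ) * b ^ t = ∑ x ∈ s.filter (fun x => b < w x), b ^ t := by simp [n]
        _ ≤ ∑ x ∈ s.filter (fun x => b < w x), w x ^ t := by
            refine Finset.sum_le_sum fun x hx => ?_
            have := (Finset.mem_filter.1 hx).2
            gcongr
        _ ≤ B := sum_le_hasSum _ (fun x _ => Real.rpow_nonneg (hw x) _) hB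
    have hbt : 0 < b ^ t := Real.rpow_pos_of_pos hb _
    have h3 : (n : ℝ) ≤ B * b ^ (-t) := by
      rw [Real.rpow_neg hb.le, ← div_eq_mul_inv, le_div_iff₀ hbt]; exact h2
    calc (n : ℝ) ^ θ ≤ (B * b ^ (-t)) ^ θ := by gcongr
      _ = B ^ θ * b ^ (-(t * θ)) := by
        rw [Real.mul_rpow hB0 (by positivity), ← Real.rpow_mul hb.le]; congr 2; ring
  have h2 : ∀ x, (if w x ≤ M then K x * ENNReal.ofReal (w x) else 0) ≤
      ∫⁻ b in Set.Ioc 0 M, K x * (if b < w x then 1 else 0) := by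
    intro x
    split_ifs with h
    · rw [lintegral_const_mul _ (by
        refine Measurable.ite ?_ measurable_const measurable_const
        exact measurableSet_Iio)]
      gcongr
      calc ENNReal.ofReal (w x) = ∫⁻ b in Set.Ioo 0 (w x), 1 := by simp
        _ = ∫⁻ b in Set.Ioo 0 (w x), (if b < w x then 1 else 0) := by
          refine setLIntegral_congr_fun measurableSet_Ioo ?_
          intro b hb
          simp [hb.2]
        _ ≤ _ := by
          refine lintegral_mono_set ?_
          intro b hb
          exact ⟨hb.1, hb.2.le.trans h⟩
    · exact zero_le
  calc _ ≤ ∑' x, ∫⁻ b in Set.Ioc 0 M, K x * (if b < w x then 1 else 0) := ENNReal.tsum_le_tsum h2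
    _ = ∫⁻ b in Set.Ioc 0 M, ∑' x, K x * (if b < w x then 1 else 0) := by
      rw [lintegral_tsum]
      intro x
      refine (Measurable.const_mul ?_ _).aemeasurable
      refine Measurable.ite ?_ measurable_const measurable_const
      exact measurableSet_Iio
    _ ≤ ∫⁻ b in Set.Ioc 0 M, C * ENNReal.ofReal (B ^ θ * b ^ (-(t * θ))) := by
      refine setLIntegral_mono' measurableSet_Ioc fun b hb => h1 b hb.1
    _ = C * ∫⁻ b in Set.Ioc 0 M, ENNReal.ofReal (B ^ θ * b ^ (-(t * θ))) := by
      refine lintegral_const_mul _ ?_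
      fun_prop
    _ = _ := by
      congr 1
      have hi : IntervalIntegrable (fun b : ℝ => b ^ (-(t * θ))) volume 0 M :=
        intervalIntegral.intervalIntegrable_rpow' (by linarith)
      rw [← ofReal_integral_eq_lintegral_ofReal]
      · congr 1
        rw [← intervalIntegral.integral_of_le hM.le, intervalIntegral.integral_const_mul,
          integral_rpow (Or.inl (by linarith)), Real.zero_rpow (by linarith)]
        congr 2
        · rw [sub_zero]; congr 1; ring
        · ring
      · exact ((intervalIntegrable_iff_integrableOn_Ioc_of_le hM.le).1 hi).const_mul _
      · refine (ae_restrict_iff' measurableSet_Ioc).2 (Eventually.of_forall fun b hb => ?_)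
        have := hb.1
        simp only [Pi.zero_apply]
        positivity

lemma hls_half {ι : Type*} [Countable ι] (K : ι → ι → ℝ≥0∞) (C : ℝ≥0∞) (θ : ℝ) (hθ : 0 < θ)
    (hK : ∀ (y : ι) (F : Finset ι), ∑ x ∈ F, K x y ≤ C * ENNReal.ofReal ((F.card : ℝ) ^ θ))
    (u v : ι → ℝ) (hu : ∀ x, 0 ≤ u x) (hv : ∀ x, 0 ≤ v x) (r t : ℝ) (hr : 1 < r) (ht : 1 < t)
    (hrt : 1 / r + 1 / t = 1 + θ) (A B : ℝ) (hA : 0 < A) (hB : 0 < B)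
    (hu' : HasSum (fun x => u x ^ r) A) (hv' : HasSum (fun x => v x ^ t) B) :
    ∑' y, ∑' x, (if v x ≤ (B / A) ^ (1 / t) * u y ^ (r / t) then
        K x y * ENNReal.ofReal (u y) * ENNReal.ofReal (v x) else 0) ≤
      C * ENNReal.ofReal (1 / (1 - t * θ) * A ^ (1 / r) * B ^ (1 / t)) := by
  have hr0 : 0 < r := by linarith
  have ht0 : 0 < t := by linarith
  have htθ : t * θ < 1 := by
    have h1 : 1 / r < 1 := by rw [div_lt_one hr0]; exact hr
    have h2 : θ < 1 / t := by linarith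
    rw [lt_div_iff₀ ht0] at h2; linarith
  have key : ∀ y, ∑' x, (if v x ≤ (B / A) ^ (1 / t) * u y ^ (r / t) then
        K x y * ENNReal.ofReal (u y) * ENNReal.ofReal (v x) else 0) ≤
      C * ENNReal.ofReal (B ^ θ * (B / A) ^ (1 / t - θ) / (1 - t * θ) * u y ^ r) := by
    intro y
    rcases (hu y).eq_or_lt with h0 | h0
    · rw [← h0]; simp
    have hM : 0 < (B / A) ^ (1 / t) * u y ^ (r / t) := by positivity
    have h := hls_partial_sum (fun x => K x y) C θ hθ (hK y) v hv t ht0 htθ B hv' _ hM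
    calc _ = ENNReal.ofReal (u y) * ∑' x, (if v x ≤ (B / A) ^ (1 / t) * u y ^ (r / t) then
        K x y * ENNReal.ofReal (v x) else 0) := by
          rw [← ENNReal.tsum_mul_left]
          refine tsum_congr fun x => ?_
          split_ifs
          · ring
          · simp
      _ ≤ ENNReal.ofReal (u y) * (C * ENNReal.ofReal (B ^ θ *
            (((B / A) ^ (1 / t) * u y ^ (r / t)) ^ (1 - t * θ) / (1 - t * θ)))) := by gcongr
      _ = C * ENNReal.ofReal (u y * (B ^ θ * (((B / A) ^ (1 / t) * u y ^ (r / t)) ^ (1 - t * θ) / (1 - t * θ)))) := by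
          rw [ENNReal.ofReal_mul h0.le]; ring
      _ = _ := by
          congr 2
          have e1 : ((B / A) ^ (1 / t) * u y ^ (r / t)) ^ (1 - t * θ)
              = (B / A) ^ (1 / t - θ) * u y ^ (r - 1) := by
            rw [Real.mul_rpow (by positivity) (by positivity), ← Real.rpow_mul (by positivity),
              ← Real.rpow_mul h0.le]
            congr 2
            · field_simp
            · have : θ = 1 / r + 1 / t - 1 := by linarith
              rw [this]; field_simp; ring
          have e2 : u y ^ r = u y * u y ^ (r - 1) := by
            rw [← Real.rpow_one_add' h0.le (by linarith)]; congr 1; ring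
          rw [e1, e2]; ring
  have hc : 0 ≤ B ^ θ * (B / A) ^ (1 / t - θ) / (1 - t * θ) := by
    have : 0 < 1 - t * θ := by linarith
    positivity
  calc _ ≤ ∑' y, C * ENNReal.ofReal (B ^ θ * (B / A) ^ (1 / t - θ) / (1 - t * θ) * u y ^ r) :=
        ENNReal.tsum_le_tsum key
    _ = C * ENNReal.ofReal (B ^ θ * (B / A) ^ (1 / t - θ) / (1 - t * θ) * A) := by
        rw [ENNReal.tsum_mul_left, ← ENNReal.ofReal_tsum_of_nonneg]
        · rw [tsum_mul_left, hu'.tsum_eq]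
        · intro y; have := Real.rpow_nonneg (hu y) r; positivity
        · exact hu'.summable.mul_left _
    _ = _ := by
        congr 2
        rw [Real.div_rpow hB.le hA.le]
        have e1 : B ^ (1 / t) = B ^ θ * B ^ (1 / t - θ) := by
          rw [← Real.rpow_add hB]; congr 1; ring
        have e2 : A ^ (1 / r) = A / A ^ (1 / t - θ) := by
          rw [eq_div_iff (by positivity), ← Real.rpow_add hA, show 1 / r + (1 / t - θ) = 1 by linarith,
            Real.rpow_one]
        rw [e1, e2]; ring

lemma hls_full {ι : Type*} [Countable ι] (K : ι → ι → ℝ≥0∞) (C : ℝ≥0∞) (θ : ℝ) (hθ : 0 < θ)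
    (hK : ∀ (y : ι) (F : Finset ι), ∑ x ∈ F, K x y ≤ C * ENNReal.ofReal ((F.card : ℝ) ^ θ))
    (hK' : ∀ (x : ι) (F : Finset ι), ∑ y ∈ F, K x y ≤ C * ENNReal.ofReal ((F.card : ℝ) ^ θ))
    (u v : ι → ℝ) (hu : ∀ x, 0 ≤ u x) (hv : ∀ x, 0 ≤ v x) (r t : ℝ) (hr : 1 < r) (ht : 1 < t)
    (hrt : 1 / r + 1 / t = 1 + θ) (A B : ℝ) 
    (hu' : HasSum (fun x => u x ^ r) A) (hv' : HasSum (fun x => v x ^ t) B) :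
    ∑' x, ∑' y, K x y * ENNReal.ofReal (u y) * ENNReal.ofReal (v x) ≤
      C * ENNReal.ofReal ((1 / (1 - t * θ) + 1 / (1 - r * θ)) * A ^ (1 / r) * B ^ (1 / t)) := by
  have hr0 : 0 < r := by linarith
  have ht0 : 0 < t := by linarith
  have htθ : t * θ < 1 := by
    have h1 : 1 / r < 1 := by rw [div_lt_one hr0]; exact hr
    have h2 : θ < 1 / t := by linarith
    rw [lt_div_iff₀ ht0] at h2; linarith
  have hrθ : r * θ < 1 := by
    have h1 : 1 / t < 1 := by rw [div_lt_one ht0]; exact ht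
    have h2 : θ < 1 / r := by linarith
    rw [lt_div_iff₀ hr0] at h2; linarith
  have zero : ∀ (w : ι → ℝ) (hw : ∀ x, 0 ≤ w x) (p : ℝ) (hp : 0 < p)
      (h : HasSum (fun x => w x ^ p) 0), ∀ x, w x = 0 := by
    intro w hw p hp h x
    have := (hasSum_zero_iff_of_nonneg (fun x => Real.rpow_nonneg (hw x) p)).1 h
    have h2 := congrFun this x
    simp only [Pi.zero_apply] at h2
    exact (Real.rpow_eq_zero (hw x) hp.ne').1 h2
  rcases (hu'.nonneg (fun x => Real.rpow_nonneg (hu x) _)).eq_or_lt with hA | hA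
  · subst hA
    simp [zero u hu r hr0 hu']
  rcases (hv'.nonneg (fun x => Real.rpow_nonneg (hv x) _)).eq_or_lt with hB | hB
  · subst hB
    simp [zero v hv t ht0 hv']
  have H1 := hls_half K C θ hθ hK u v hu hv r t hr ht hrt A B hA hB hu' hv'
  have H2 := hls_half (fun y x => K x y) C θ hθ hK' v u hv hu t r ht hr (by linarith) B A hB hA hv' hu'
  rw [ENNReal.tsum_comm] at H1
  have hsplit : ∀ x y, K x y * ENNReal.ofReal (u y) * ENNReal.ofReal (v x) ≤
      (if v x ≤ (B / A) ^ (1 / t) * u y ^ (r / t) then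
        K x y * ENNReal.ofReal (u y) * ENNReal.ofReal (v x) else 0) +
      (if u y ≤ (A / B) ^ (1 / r) * v x ^ (t / r) then
        K x y * ENNReal.ofReal (v x) * ENNReal.ofReal (u y) else 0) := by
    intro x y
    by_cases h : v x ≤ (B / A) ^ (1 / t) * u y ^ (r / t)
    · rw [if_pos h]; exact le_self_add
    · have h' : u y ≤ (A / B) ^ (1 / r) * v x ^ (t / r) := by
        push Not at h
        have hu0 := hu y
        have e1 : ((B / A) ^ (1 / t) * u y ^ (r / t)) ^ (t / r) ≤ v x ^ (t / r) := by
          gcongr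
        rw [Real.mul_rpow (by positivity) (by positivity), ← Real.rpow_mul (by positivity),
          ← Real.rpow_mul hu0, show r / t * (t / r) = 1 by field_simp,
          show 1 / t * (t / r) = 1 / r by field_simp, Real.rpow_one] at e1
        calc u y = (A / B) ^ (1 / r) * ((B / A) ^ (1 / r) * u y) := by
              rw [← mul_assoc, ← Real.mul_rpow (by positivity) (by positivity),
                show A / B * (B / A) = 1 by field_simp]; simp
          _ ≤ _ := by gcongr
      rw [if_pos h']
      refine le_trans (le_of_eq ?_) le_add_self
      ring
  calc _ ≤ ∑' x, ∑' y, ((if v x ≤ (B / A) ^ (1 / t) * u y ^ (r / t) then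
        K x y * ENNReal.ofReal (u y) * ENNReal.ofReal (v x) else 0) +
      (if u y ≤ (A / B) ^ (1 / r) * v x ^ (t / r) then
        K x y * ENNReal.ofReal (v x) * ENNReal.ofReal (u y) else 0)) :=
        ENNReal.tsum_le_tsum fun x => ENNReal.tsum_le_tsum fun y => hsplit x y
    _ ≤ _ := by
        simp_rw [ENNReal.tsum_add]
        refine (add_le_add H1 H2).trans (le_of_eq ?_)
        have h1 : 0 < 1 - t * θ := by linarith
        have h2 : 0 < 1 - r * θ := by linarith
        rw [← mul_add, ← ENNReal.ofReal_add (by positivity) (by positivity)]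
        congr 2; ring

/-- Poisson weights. -/
def hkW (s : ℝ) (j : ℕ) : ℝ := Real.exp (-s) * (s ^ j / j.factorial)

lemma hkW_nonneg {s : ℝ} (hs : 0 ≤ s) (j : ℕ) : 0 ≤ hkW s j := by unfold hkW; positivity

lemma hkW_hasSum (s : ℝ) : HasSum (hkW s) 1 := by
  have h := (NormedSpace.expSeries_div_hasSum_exp s).mul_left (Real.exp (-s))
  rw [← Real.exp_eq_exp_ℝ, ← Real.exp_add] at h
  rw [neg_add_cancel, Real.exp_zero] at h
  exact h

lemma hkW_hasSum_exp (s : ℝ) (z : ℂ) :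
    HasSum (fun j : ℕ => (hkW s j : ℂ) * z ^ j) (Complex.exp (-s) * Complex.exp (s * z)) := by
  have h := (NormedSpace.expSeries_div_hasSum_exp ((s : ℂ) * z)).mul_left (Complex.exp (-s))
  rw [← Complex.exp_eq_exp_ℂ] at h
  have e : (fun j : ℕ => (hkW s j : ℂ) * z ^ j) =
      fun j : ℕ => Complex.exp (-s) * (((s : ℂ) * z) ^ j / (j.factorial : ℂ)) := by
    funext j
    unfold hkW
    push_cast
    rw [mul_pow]; ring
  rw [e]
  exact h

lemma hkW_hasSum_exp_mul {s : ℝ} (hs : 0 ≤ s) (z w : ℂ) (hz : ‖z‖ = 1) (hw : ‖w‖ = 1) :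
    HasSum (fun p : ℕ × ℕ => (hkW s p.1 : ℂ) * z ^ p.1 * ((hkW s p.2 : ℂ) * w ^ p.2))
      (Complex.exp (-s) * Complex.exp (s * z) * (Complex.exp (-s) * Complex.exp (s * w))) := by
  have hn : ∀ z : ℂ, ‖z‖ = 1 → Summable fun j : ℕ => ‖(hkW s j : ℂ) * z ^ j‖ := by
    intro z hz
    refine (hkW_hasSum s).summable.congr fun j => ?_
    rw [norm_mul, norm_pow, hz, one_pow, mul_one, Complex.norm_real,
      Real.norm_of_nonneg (hkW_nonneg hs j)]
  have h : Summable (fun p : ℕ × ℕ => (hkW s p.1 : ℂ) * z ^ p.1 * ((hkW s p.2 : ℂ) * w ^ p.2)) :=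
    summable_mul_of_summable_norm (f := fun j : ℕ => (hkW s j : ℂ) * z ^ j)
      (g := fun j : ℕ => (hkW s j : ℂ) * w ^ j) (hn z hz) (hn w hw)
  exact HasSum.mul (f := fun j : ℕ => (hkW s j : ℂ) * z ^ j)
      (g := fun j : ℕ => (hkW s j : ℂ) * w ^ j) (hkW_hasSum_exp s z) (hkW_hasSum_exp s w) h

/-- One dimensional lattice heat kernel. -/
def hkP (s : ℝ) (n : ℤ) : ℝ :=
  ∑' p : ℕ × ℕ, if (p.1 : ℤ) - p.2 + n = 0 then hkW s p.1 * hkW s p.2 else 0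

lemma hkW_prod_hasSum {s : ℝ} (hs : 0 ≤ s) :
    HasSum (fun p : ℕ × ℕ => hkW s p.1 * hkW s p.2) 1 := by
  have h := (hkW_hasSum s).mul (hkW_hasSum s) ((hkW_hasSum s).summable.mul_of_nonneg
    (hkW_hasSum s).summable (hkW_nonneg hs) (hkW_nonneg hs))
  simpa using h

lemma hkP_summable {s : ℝ} (hs : 0 ≤ s) (n : ℤ) :
    Summable (fun p : ℕ × ℕ => if (p.1 : ℤ) - p.2 + n = 0 then hkW s p.1 * hkW s p.2 else 0) := by
  refine (hkW_prod_hasSum hs).summable.of_nonneg_of_le (fun p => ?_) (fun p => ?_)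
  · have := hkW_nonneg hs p.1
    have := hkW_nonneg hs p.2
    split_ifs <;> positivity
  · have := hkW_nonneg hs p.1
    have := hkW_nonneg hs p.2
    split_ifs
    · exact le_rfl
    · positivity

lemma hkP_nonneg {s : ℝ} (hs : 0 ≤ s) (n : ℤ) : 0 ≤ hkP s n := by
  refine tsum_nonneg fun p => ?_
  have := hkW_nonneg hs p.1
  have := hkW_nonneg hs p.2
  split_ifs <;> positivity

lemma hkP_sum_le {s : ℝ} (hs : 0 ≤ s) (F : Finset ℤ) : ∑ n ∈ F, hkP s n ≤ 1 := by
  unfold hkP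
  rw [← Summable.tsum_finsetSum (fun n _ => hkP_summable hs n), ← (hkW_prod_hasSum hs).tsum_eq]
  refine Summable.tsum_le_tsum (fun p => ?_) (summable_sum fun n _ => hkP_summable hs n)
    (hkW_prod_hasSum hs).summable
  have h0 : 0 ≤ hkW s p.1 * hkW s p.2 := mul_nonneg (hkW_nonneg hs _) (hkW_nonneg hs _)
  have e : ∀ n : ℤ, ((p.1 : ℤ) - p.2 + n = 0) ↔ (n = (p.2 : ℤ) - p.1) := by intro n; omega
  simp_rw [e]
  rw [Finset.sum_ite_eq']
  split_ifs
  · exact le_rfl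
  · exact h0

lemma hk_integral_exp (m : ℤ) :
    ∫ θ in Set.Icc 0 (2 * Real.pi), Complex.exp (Complex.I * m * θ) =
      if m = 0 then (2 * Real.pi : ℂ) else 0 := by
  rw [integral_Icc_eq_integral_Ioc, ← intervalIntegral.integral_of_le (by positivity)]
  split_ifs with h
  · subst h; simp
  · have hm : Complex.I * m ≠ 0 := mul_ne_zero Complex.I_ne_zero (by exact_mod_cast h)
    rw [integral_exp_mul_complex hm]
    have : Complex.exp (Complex.I * m * ((2 * Real.pi : ℝ) : ℂ)) = 1 := by
      rw [Complex.exp_eq_one_iff]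
      exact ⟨m, by push_cast; ring⟩
    rw [this]; simp

lemma hk_fourier {s : ℝ} (hs : 0 ≤ s) (n : ℤ) :
    ∫ θ in Set.Icc 0 (2 * Real.pi), Complex.exp (Complex.I * n * θ) *
      (Real.exp (-(2 * s * (1 - Real.cos θ))) : ℂ) = 2 * Real.pi * (hkP s n : ℂ) := by
  let F : ℕ × ℕ → ℝ → ℂ := fun p θ => ((hkW s p.1 * hkW s p.2 : ℝ) : ℂ) *
    Complex.exp (Complex.I * ((p.1 : ℤ) - p.2 + n : ℤ) * θ)
  have hFn : ∀ p θ, ‖F p θ‖ = hkW s p.1 * hkW s p.2 := by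
    intro p θ
    have h0 : 0 ≤ hkW s p.1 * hkW s p.2 := mul_nonneg (hkW_nonneg hs _) (hkW_nonneg hs _)
    simp only [F]
    rw [norm_mul, Complex.norm_real, Real.norm_of_nonneg h0,
      show Complex.I * (((p.1 : ℤ) - p.2 + n : ℤ) : ℂ) * (θ : ℂ) =
        ((((p.1 : ℤ) - p.2 + n : ℤ) * θ : ℝ) : ℂ) * Complex.I by push_cast; ring,
      Complex.norm_exp_ofReal_mul_I, mul_one]
  have hsum : ∀ θ : ℝ, HasSum (fun p => F p θ) (Complex.exp (Complex.I * n * θ) *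
      (Real.exp (-(2 * s * (1 - Real.cos θ))) : ℂ)) := by
    intro θ
    have z1 : ‖Complex.exp (Complex.I * θ)‖ = 1 := by
      rw [mul_comm]; exact Complex.norm_exp_ofReal_mul_I θ
    have z2 : ‖Complex.exp (-(Complex.I * θ))‖ = 1 := by
      rw [Complex.exp_neg, norm_inv, z1, inv_one]
    have h3 := (hkW_hasSum_exp_mul hs _ _ z1 z2).mul_left (Complex.exp (Complex.I * n * θ))
    have e1 : (fun p => F p θ) = fun p : ℕ × ℕ => Complex.exp (Complex.I * n * θ) *
        ((hkW s p.1 : ℂ) * Complex.exp (Complex.I * θ) ^ p.1 *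
          ((hkW s p.2 : ℂ) * Complex.exp (-(Complex.I * θ)) ^ p.2)) := by
      funext p
      simp only [F]
      rw [show Complex.I * (((p.1 : ℤ) - p.2 + n : ℤ) : ℂ) * (θ : ℂ) =
        Complex.I * n * θ + ((p.1 : ℂ) * (Complex.I * θ) + (p.2 : ℂ) * (-(Complex.I * θ))) by
          push_cast; ring, Complex.exp_add, Complex.exp_add, Complex.exp_nat_mul,
          Complex.exp_nat_mul]
      push_cast
      ring
    have e2 : (Real.exp (-(2 * s * (1 - Real.cos θ))) : ℂ) =
        Complex.exp (-s) * Complex.exp (s * Complex.exp (Complex.I * θ)) *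
          (Complex.exp (-s) * Complex.exp (s * Complex.exp (-(Complex.I * θ)))) := by
      rw [← Complex.exp_add, ← Complex.exp_add, ← Complex.exp_add, Complex.ofReal_exp]
      congr 1
      push_cast
      rw [Complex.cos, mul_comm (θ : ℂ) Complex.I, neg_mul, mul_comm (θ : ℂ) Complex.I]
      ring
    rw [e1, e2]
    exact h3
  have hF_int : ∀ p, Integrable (F p) (volume.restrict (Set.Icc 0 (2 * Real.pi))) := by
    intro p
    have : Continuous (F p) := by simp only [F]; fun_prop
    exact this.continuousOn.integrableOn_compact isCompact_Icc
  have hF_sum : Summable fun p => ∫ θ in Set.Icc 0 (2 * Real.pi), ‖F p θ‖ := by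
    simp_rw [hFn]
    simp only [integral_const]
    exact (hkW_prod_hasSum hs).summable.const_smul _
  have h := hasSum_integral_of_summable_integral_norm hF_int hF_sum
  have e : ∀ θ : ℝ, ∑' p, F p θ = Complex.exp (Complex.I * n * θ) *
      (Real.exp (-(2 * s * (1 - Real.cos θ))) : ℂ) := fun θ => (hsum θ).tsum_eq
  simp_rw [e] at h
  rw [← h.tsum_eq]
  unfold hkP
  rw [Complex.ofReal_tsum, ← tsum_mul_left]
  refine tsum_congr fun p => ?_
  simp only [F]
  rw [integral_const_mul, hk_integral_exp]
  split_ifs <;> simp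
  ring

lemma hk_exp_bound {s θ : ℝ} (hs : 0 ≤ s) (h : θ ∈ Set.Icc 0 (2 * Real.pi)) :
    Real.exp (-(2 * s * (1 - Real.cos θ))) ≤
      Real.exp (-(4 / Real.pi ^ 2 * s) * θ ^ 2) +
      Real.exp (-(4 / Real.pi ^ 2 * s) * (θ - 2 * Real.pi) ^ 2) := by
  have key : ∀ x : ℝ, |x| ≤ Real.pi → Real.exp (-(2 * s * (1 - Real.cos x))) ≤
      Real.exp (-(4 / Real.pi ^ 2 * s) * x ^ 2) := by
    intro x hx
    have := Real.cos_le_one_sub_mul_cos_sq hx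
    rw [Real.exp_le_exp]
    have h2 := mul_le_mul_of_nonneg_left this (by linarith : 0 ≤ 2 * s)
    calc _ = 2 * s * Real.cos x - 2 * s := by ring
      _ ≤ 2 * s * (1 - 2 / Real.pi ^ 2 * x ^ 2) - 2 * s := by linarith
      _ = _ := by ring
  rcases le_total θ Real.pi with h1 | h1
  · have := key θ (abs_le.2 ⟨by linarith [h.1, Real.pi_pos], h1⟩)
    linarith [Real.exp_pos (-(4 / Real.pi ^ 2 * s) * (θ - 2 * Real.pi) ^ 2)]
  · have := key (θ - 2 * Real.pi) (abs_le.2 ⟨by linarith [h.1, Real.pi_pos], by linarith [h.2, Real.pi_pos]⟩)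
    rw [Real.cos_sub_two_pi] at this
    linarith [Real.exp_pos (-(4 / Real.pi ^ 2 * s) * θ ^ 2)]

lemma hkP_le {s : ℝ} (hs : 0 < s) (n : ℤ) : hkP s n ≤ Real.pi * s ^ (-(1 / 2 : ℝ)) := by
  have hpi := Real.pi_pos
  have hb : 0 < 4 / Real.pi ^ 2 * s := by positivity
  have h1 : ‖∫ θ in Set.Icc 0 (2 * Real.pi), Complex.exp (Complex.I * n * θ) *
      (Real.exp (-(2 * s * (1 - Real.cos θ))) : ℂ)‖ ≤
      ∫ θ in Set.Icc 0 (2 * Real.pi), (Real.exp (-(4 / Real.pi ^ 2 * s) * θ ^ 2) +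
      Real.exp (-(4 / Real.pi ^ 2 * s) * (θ - 2 * Real.pi) ^ 2)) := by
    refine norm_integral_le_of_norm_le ?_ ?_
    · have : Continuous (fun θ : ℝ => (Real.exp (-(4 / Real.pi ^ 2 * s) * θ ^ 2) +
        Real.exp (-(4 / Real.pi ^ 2 * s) * (θ - 2 * Real.pi) ^ 2))) := by fun_prop
      exact this.continuousOn.integrableOn_compact isCompact_Icc
    · refine (ae_restrict_iff' measurableSet_Icc).2 (Eventually.of_forall fun θ hθ => ?_)
      rw [norm_mul, mul_assoc, show Complex.I * ((n : ℂ) * (θ : ℂ)) = ((n * θ : ℝ) : ℂ) * Complex.I by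
        push_cast; ring, Complex.norm_exp_ofReal_mul_I, one_mul, Complex.norm_real,
        Real.norm_of_nonneg (Real.exp_pos _).le]
      exact hk_exp_bound hs.le hθ
  have i1 := integrable_exp_neg_mul_sq hb
  have i2 := i1.comp_sub_right (2 * Real.pi)
  have h2 : ∫ θ in Set.Icc 0 (2 * Real.pi), (Real.exp (-(4 / Real.pi ^ 2 * s) * θ ^ 2) +
      Real.exp (-(4 / Real.pi ^ 2 * s) * (θ - 2 * Real.pi) ^ 2)) ≤
      2 * √(Real.pi / (4 / Real.pi ^ 2 * s)) := by
    refine (setIntegral_le_integral (i1.add i2) (Eventually.of_forall fun θ => by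
      simp only [Pi.zero_apply, Pi.add_apply]; positivity)).trans (le_of_eq ?_)
    simp only [Pi.add_apply]
    rw [integral_add i1 i2, integral_sub_right_eq_self (fun θ : ℝ => Real.exp (-(4 / Real.pi ^ 2 * s) * θ ^ 2)),
      integral_gaussian]
    ring
  rw [hk_fourier hs.le] at h1
  have h3 : ‖(2 * Real.pi * (hkP s n : ℂ) : ℂ)‖ = 2 * Real.pi * hkP s n := by
    rw [show (2 * Real.pi * (hkP s n : ℂ) : ℂ) = ((2 * Real.pi * hkP s n : ℝ) : ℂ) by push_cast; rfl,
      Complex.norm_real, Real.norm_of_nonneg]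
    have := hkP_nonneg hs.le n
    positivity
  have h4 : √(Real.pi / (4 / Real.pi ^ 2 * s)) ≤ Real.pi ^ 2 * s ^ (-(1 / 2 : ℝ)) := by
    rw [Real.rpow_neg hs.le, ← Real.sqrt_eq_rpow]
    apply Real.sqrt_le_iff.2 ⟨by positivity, ?_⟩
    rw [mul_pow, inv_pow, Real.sq_sqrt hs.le]
    rw [div_le_iff₀ hb]
    have : Real.pi ≤ Real.pi ^ 2 := by nlinarith [Real.pi_gt_three]
    field_simp
    nlinarith [Real.pi_gt_three]
  rw [h3] at h1
  have h5 : 2 * Real.pi * hkP s n ≤ 2 * Real.pi * (Real.pi * s ^ (-(1 / 2 : ℝ))) := by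
    nlinarith
  exact le_of_mul_le_mul_left h5 (by positivity)

/-- The `d`-dimensional lattice heat kernel. -/
def hkH (d : ℕ) (s : ℝ) (z : Z d) : ℝ := ∏ j, hkP s (z j)

lemma hkH_nonneg {d : ℕ} {s : ℝ} (hs : 0 ≤ s) (z : Z d) : 0 ≤ hkH d s z :=
  Finset.prod_nonneg fun j _ => hkP_nonneg hs _

lemma hkH_le {d : ℕ} {s : ℝ} (hs : 0 < s) (z : Z d) :
    hkH d s z ≤ Real.pi ^ d * s ^ (-((d : ℝ) / 2)) := by
  calc hkH d s z ≤ ∏ _j : Fin d, (Real.pi * s ^ (-(1 / 2 : ℝ))) :=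
        Finset.prod_le_prod (fun j _ => hkP_nonneg hs.le _) (fun j _ => hkP_le hs _)
    _ = _ := by
        rw [Finset.prod_const, Finset.card_univ, Fintype.card_fin, mul_pow, ← Real.rpow_mul_natCast hs.le]
        congr 2; ring

lemma hkH_sum_le {d : ℕ} {s : ℝ} (hs : 0 ≤ s) (F : Finset (Z d)) : ∑ z ∈ F, hkH d s z ≤ 1 := by
  classical
  let t : Fin d → Finset ℤ := fun i => F.image (fun z => z i)
  have hsub : F ⊆ Fintype.piFinset t := by
    intro z hz
    rw [Fintype.mem_piFinset]
    intro i
    exact Finset.mem_image_of_mem (fun z : Z d => z i) hz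
  calc ∑ z ∈ F, hkH d s z ≤ ∑ z ∈ Fintype.piFinset t, hkH d s z :=
        Finset.sum_le_sum_of_subset_of_nonneg hsub fun z _ _ => hkH_nonneg hs z
    _ = ∏ i, ∑ n ∈ t i, hkP s n := by
        rw [Finset.prod_univ_sum]; rfl
    _ ≤ 1 := Finset.prod_le_one (fun i _ => Finset.sum_nonneg fun n _ => hkP_nonneg hs n)
        (fun i _ => hkP_sum_le hs _)

lemma hkH_sum_inj_le {d : ℕ} {s : ℝ} (hs : 0 ≤ s) (g : Z d → Z d) (hg : Function.Injective g)
    (F : Finset (Z d)) : ∑ z ∈ F, hkH d s (g z) ≤ 1 := by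
  classical
  rw [← Finset.sum_image (f := fun z => hkH d s z) (fun a _ b _ h => hg h)]
  exact hkH_sum_le hs _

lemma muk_nonneg (d : ℕ) (k : Fin d → ℝ) : 0 ≤ muk d k := by
  unfold muk
  have : ∑ j, Real.cos (k j) ≤ ∑ _j : Fin d, (1 : ℝ) := Finset.sum_le_sum fun j _ => Real.cos_le_one _
  simp at this
  linarith

lemma muk_continuous (d : ℕ) : Continuous (muk d) := by
  unfold muk; fun_prop

lemma box_compact (d : ℕ) : IsCompact (box d) := isCompact_univ_pi fun _ => isCompact_Icc

lemma box_measurable (d : ℕ) : MeasurableSet (box d) := (box_compact d).isClosed.measurableSet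

lemma hk_box {d : ℕ} {s : ℝ} (hs : 0 ≤ s) (z : Z d) :
    ∫ k in box d, Real.cos (∑ j, (z j : ℝ) * k j) * Real.exp (-(s * muk d k)) =
      (2 * Real.pi) ^ d * hkH d s z := by
  have h1 : ∫ k in box d, ∏ j, (Complex.exp (Complex.I * z j * k j) *
      (Real.exp (-(2 * s * (1 - Real.cos (k j)))) : ℂ)) = ((2 * Real.pi) ^ d * hkH d s z : ℝ) := by
    unfold box
    rw [volume_pi, Measure.restrict_pi_pi, integral_fintype_prod_eq_prod (fun j (x : ℝ) =>
      Complex.exp (Complex.I * z j * x) * (Real.exp (-(2 * s * (1 - Real.cos x))) : ℂ))]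
    simp_rw [hk_fourier hs]
    rw [Finset.prod_mul_distrib]
    simp [hkH]
  have e : ∀ k : Fin d → ℝ, Real.cos (∑ j, (z j : ℝ) * k j) * Real.exp (-(s * muk d k)) =
      (∏ j, (Complex.exp (Complex.I * z j * k j) *
      (Real.exp (-(2 * s * (1 - Real.cos (k j)))) : ℂ))).re := by
    intro k
    rw [Finset.prod_mul_distrib, ← Complex.exp_sum, ← Complex.ofReal_prod, ← Real.exp_sum,
      Complex.re_mul_ofReal]
    congr 1
    · rw [show ∑ j, Complex.I * (z j : ℂ) * (k j : ℂ) = ((∑ j, (z j : ℝ) * k j : ℝ) : ℂ) * Complex.I by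
        push_cast; rw [Finset.sum_mul]; exact Finset.sum_congr rfl fun j _ => by ring,
        Complex.exp_ofReal_mul_I_re]
    · congr 1
      unfold muk
      rw [Finset.sum_neg_distrib, ← Finset.mul_sum, Finset.sum_sub_distrib]
      simp; ring
  simp_rw [e]
  have hi : Integrable (fun k : Fin d → ℝ => ∏ j, (Complex.exp (Complex.I * z j * k j) *
      (Real.exp (-(2 * s * (1 - Real.cos (k j)))) : ℂ))) (volume.restrict (box d)) := by
    refine ContinuousOn.integrableOn_compact (box_compact d) (Continuous.continuousOn ?_)
    fun_prop
  have h2 := integral_re hi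
  simp only [RCLike.re_to_complex] at h2
  rw [h2, h1, Complex.ofReal_re]

lemma hk_dom {a δ D T : ℝ} (ha : 0 < a) (hδ : a < δ) (hT : 0 < T) (φ : ℝ → ℝ)
    (hφm : AEStronglyMeasurable φ (volume.restrict (Set.Ioi 0)))
    (h0 : ∀ s, 0 < s → 0 ≤ φ s) (h1 : ∀ s, 0 < s → φ s ≤ 1)
    (h2 : ∀ s, 0 < s → φ s ≤ D * s ^ (-δ)) :
    IntegrableOn (fun s => s ^ (a - 1) * φ s) (Set.Ioi 0) ∧
      ∫ s in Set.Ioi 0, s ^ (a - 1) * φ s ≤ T ^ a / a + D * (T ^ (a - δ) / (δ - a)) := by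
  have hu : Set.Ioi (0 : ℝ) = Set.Ioc 0 T ∪ Set.Ioi T := (Set.Ioc_union_Ioi_eq_Ioi hT.le).symm
  have hm : AEStronglyMeasurable (fun s : ℝ => s ^ (a - 1) * φ s) (volume.restrict (Set.Ioi 0)) :=
    (by fun_prop : Measurable fun s : ℝ => s ^ (a - 1)).aestronglyMeasurable.mul hφm
  have j1 : IntegrableOn (fun s : ℝ => s ^ (a - 1)) (Set.Ioc 0 T) :=
    (intervalIntegrable_iff_integrableOn_Ioc_of_le hT.le).1
      (intervalIntegral.intervalIntegrable_rpow' (by linarith))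
  have j2 : IntegrableOn (fun s : ℝ => D * s ^ (a - 1 - δ)) (Set.Ioi T) :=
    (integrableOn_Ioi_rpow_of_lt (by linarith) hT).const_mul _
  have b1 : ∀ s ∈ Set.Ioc 0 T, s ^ (a - 1) * φ s ≤ s ^ (a - 1) := fun s hs =>
    mul_le_of_le_one_right (Real.rpow_nonneg hs.1.le _) (h1 s hs.1)
  have b2 : ∀ s ∈ Set.Ioi T, s ^ (a - 1) * φ s ≤ D * s ^ (a - 1 - δ) := by
    intro s hs
    have hs0 : 0 < s := hT.trans hs
    calc _ ≤ s ^ (a - 1) * (D * s ^ (-δ)) := by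
          have := h2 s hs0; gcongr
      _ = _ := by rw [sub_eq_add_neg (a - 1) δ, Real.rpow_add hs0]; ring
  have nn : ∀ s, 0 < s → 0 ≤ s ^ (a - 1) * φ s := fun s hs =>
    mul_nonneg (Real.rpow_nonneg hs.le _) (h0 s hs)
  have i1 : IntegrableOn (fun s => s ^ (a - 1) * φ s) (Set.Ioc 0 T) := by
    refine Integrable.mono' j1 (hm.mono_set Set.Ioc_subset_Ioi_self) ?_
    refine (ae_restrict_iff' measurableSet_Ioc).2 (Eventually.of_forall fun s hs => ?_)
    rw [Real.norm_of_nonneg (nn s hs.1)]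
    exact b1 s hs
  have i2 : IntegrableOn (fun s => s ^ (a - 1) * φ s) (Set.Ioi T) := by
    refine Integrable.mono' j2 (hm.mono_set (Set.Ioi_subset_Ioi hT.le)) ?_
    refine (ae_restrict_iff' measurableSet_Ioi).2 (Eventually.of_forall fun s hs => ?_)
    rw [Real.norm_of_nonneg (nn s (hT.trans hs))]
    exact b2 s hs
  refine ⟨hu ▸ i1.union i2, ?_⟩
  rw [hu, setIntegral_union (Set.Ioc_disjoint_Ioi le_rfl) measurableSet_Ioi i1 i2]
  refine add_le_add ?_ ?_
  · refine (setIntegral_mono_on i1 j1 measurableSet_Ioc b1).trans (le_of_eq ?_)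
    rw [← intervalIntegral.integral_of_le hT.le, integral_rpow (Or.inl (by linarith)),
      sub_add_cancel, Real.zero_rpow ha.ne', sub_zero]
  · refine (setIntegral_mono_on i2 j2 measurableSet_Ioi b2).trans (le_of_eq ?_)
    rw [integral_const_mul, integral_Ioi_rpow_of_lt (by linarith) hT]
    rw [show a - 1 - δ + 1 = a - δ by ring, neg_div, ← div_neg, neg_sub]

lemma hkH_measurable {d : ℕ} (z : Z d) :
    AEStronglyMeasurable (fun s => hkH d s z) (volume.restrict (Set.Ioi 0)) := by
  have h1 : StronglyMeasurable (fun p : ℝ × (Fin d → ℝ) =>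
      Real.cos (∑ j, (z j : ℝ) * p.2 j) * Real.exp (-(p.1 * muk d p.2))) := by
    have := muk_continuous d
    exact Continuous.stronglyMeasurable (by fun_prop)
  have h2 := (h1.integral_prod_right' (ν := volume.restrict (box d))).aestronglyMeasurable
    (μ := volume.restrict (Set.Ioi (0 : ℝ)))
  have h3 := h2.const_mul ((2 * Real.pi) ^ d)⁻¹
  refine h3.congr ?_
  refine (ae_restrict_iff' measurableSet_Ioi).2 (Eventually.of_forall fun s hs => ?_)
  simp only
  rw [hk_box (le_of_lt hs)]
  have := Real.pi_pos
  field_simp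

lemma muk_pos_ae {d : ℕ} (hd : 0 < d) : ∀ᵐ k ∂(volume.restrict (box d)), 0 < muk d k := by
  have h1 : ∀ᵐ k : Fin d → ℝ, k ⟨0, hd⟩ ≠ 0 := by
    rw [volume_pi]; exact Measure.ae_eval_ne _ _ _
  have h2 : ∀ᵐ k : Fin d → ℝ, k ⟨0, hd⟩ ≠ 2 * Real.pi := by
    rw [volume_pi]; exact Measure.ae_eval_ne _ _ _
  rw [ae_restrict_iff' (box_measurable d)]
  filter_upwards [h1, h2] with k hk1 hk2 hk
  have hk0 := hk ⟨0, hd⟩ (Set.mem_univ _)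
  have hlt : Real.cos (k ⟨0, hd⟩) < 1 := by
    refine lt_of_le_of_ne (Real.cos_le_one _) fun h => ?_
    have a1 : 0 < k ⟨0, hd⟩ := lt_of_le_of_ne hk0.1 (Ne.symm hk1)
    have a2 : k ⟨0, hd⟩ < 2 * Real.pi := lt_of_le_of_ne hk0.2 hk2
    exact hk1 ((Real.cos_eq_one_iff_of_lt_of_lt (by linarith [Real.pi_pos]) a2).1 h)
  have : ∑ j, Real.cos (k j) < ∑ _j : Fin d, (1 : ℝ) :=
    Finset.sum_lt_sum (fun j _ => Real.cos_le_one _) ⟨_, Finset.mem_univ _, hlt⟩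
  simp at this
  unfold muk
  linarith

lemma riesz_integral {d : ℕ} (hd : 0 < d) {a : ℝ} (ha : 0 < a) (had : a < (d : ℝ) / 2) (z : Z d) :
    ∫ k in box d, Real.cos (∑ j, (z j : ℝ) * k j) * muk d k ^ (-a) =
      (Real.Gamma a)⁻¹ * ((2 * Real.pi) ^ d * ∫ s in Set.Ioi 0, s ^ (a - 1) * hkH d s z) := by
  have hΓ : 0 < Real.Gamma a := Real.Gamma_pos_of_pos ha
  have hmc := muk_continuous d
  let G : ℝ × (Fin d → ℝ) → ℝ := fun p => p.1 ^ (a - 1) * Real.exp (-(p.1 * muk d p.2))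
  have hGm : Measurable G := by
    have : Measurable fun p : ℝ × (Fin d → ℝ) => Real.exp (-(p.1 * muk d p.2)) :=
      Continuous.measurable (by fun_prop)
    exact Measurable.mul (by fun_prop) this
  have hbox0 : ∀ s : ℝ, 0 ≤ s → ∫ k in box d, Real.exp (-(s * muk d k)) =
      (2 * Real.pi) ^ d * hkH d s 0 := by
    intro s hs
    rw [← hk_box hs 0]
    simp
  have hG : Integrable G ((volume.restrict (Set.Ioi 0)).prod (volume.restrict (box d))) := by
    rw [integrable_prod_iff hGm.aestronglyMeasurable]
    constructor
    · refine Eventually.of_forall fun s => ?_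
      refine ContinuousOn.integrableOn_compact (box_compact d) (Continuous.continuousOn ?_)
      simp only [G]
      fun_prop
    · have h := (hk_dom ha had one_pos (fun s => hkH d s 0) (hkH_measurable 0)
        (fun s hs => hkH_nonneg hs.le _) (fun s hs => by simpa using hkH_sum_le hs.le {(0 : Z d)})
        (D := Real.pi ^ d) (fun s hs => hkH_le hs 0)).1.const_mul ((2 * Real.pi) ^ d)
      refine Integrable.congr h ?_
      refine (ae_restrict_iff' measurableSet_Ioi).2 (Eventually.of_forall fun s hs => ?_)
      have hs0 : (0 : ℝ) < s := hs
      have e : ∀ k, ‖G (s, k)‖ = s ^ (a - 1) * Real.exp (-(s * muk d k)) := by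
        intro k
        rw [Real.norm_of_nonneg]
        simp only [G]
        positivity
      simp_rw [e]
      rw [integral_const_mul, hbox0 s hs0.le]
      ring
  let f : ℝ → (Fin d → ℝ) → ℝ := fun s k =>
    s ^ (a - 1) * (Real.cos (∑ j, (z j : ℝ) * k j) * Real.exp (-(s * muk d k)))
  have hf : Integrable (Function.uncurry f)
      ((volume.restrict (Set.Ioi 0)).prod (volume.restrict (box d))) := by
    have hb := hG.bdd_mul (f := fun p : ℝ × (Fin d → ℝ) => Real.cos (∑ j, (z j : ℝ) * p.2 j)) (c := 1)
      (Continuous.aestronglyMeasurable (by fun_prop))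
      (Eventually.of_forall fun p => by simpa using Real.abs_cos_le_one _)
    refine hb.congr (Eventually.of_forall fun p => ?_)
    simp only [f, G, Function.uncurry]
    ring
  have hswap := integral_integral_swap hf
  have hL : ∫ s in Set.Ioi 0, ∫ k in box d, f s k =
      (2 * Real.pi) ^ d * ∫ s in Set.Ioi 0, s ^ (a - 1) * hkH d s z := by
    rw [← integral_const_mul]
    refine setIntegral_congr_fun measurableSet_Ioi fun s hs => ?_
    simp only [f]
    rw [integral_const_mul, hk_box (le_of_lt hs)]
    ring
  have hR : ∫ k in box d, ∫ s in Set.Ioi 0, f s k =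
      Real.Gamma a * ∫ k in box d, Real.cos (∑ j, (z j : ℝ) * k j) * muk d k ^ (-a) := by
    rw [← integral_const_mul]
    refine integral_congr_ae ?_
    filter_upwards [muk_pos_ae hd] with k hk
    have e : ∀ s, f s k = Real.cos (∑ j, (z j : ℝ) * k j) *
        (s ^ (a - 1) * Real.exp (-(muk d k * s))) := by
      intro s; simp only [f]; rw [mul_comm s (muk d k)]; ring
    simp_rw [e]
    rw [integral_const_mul, Real.integral_rpow_mul_exp_neg_mul_Ioi ha hk, one_div,
      Real.inv_rpow hk.le, ← Real.rpow_neg hk.le]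
    ring
  rw [← hL, hswap, hR]
  field_simp

lemma riesz_eq {d : ℕ} (hd : 0 < d) {α : ℝ} (hα : α ∈ Set.Ioo (0 : ℝ) (d : ℝ)) (x y : Z d) :
    Riesz d α x y = Kfrac d α * (Real.Gamma (α / 2))⁻¹ *
      ∫ s in Set.Ioi 0, s ^ (α / 2 - 1) * hkH d s (x - y) := by
  have h := riesz_integral hd (a := α / 2) (by linarith [hα.1]) (by linarith [hα.2]) (x - y)
  unfold Riesz
  simp only [Pi.sub_apply] at h
  rw [h, Real.rpow_neg (by positivity), Real.rpow_natCast]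
  have := Real.pi_pos
  field_simp

lemma Kfrac_nonneg (d : ℕ) (α : ℝ) : 0 ≤ Kfrac d α := by
  unfold Kfrac
  refine mul_nonneg (by positivity) (integral_nonneg fun k => Real.rpow_nonneg (muk_nonneg d k) _)

lemma riesz_sum {d : ℕ} (hd : 0 < d) {α : ℝ} (hα : α ∈ Set.Ioo (0 : ℝ) (d : ℝ))
    (g : Z d → Z d) (hg : Function.Injective g) (F : Finset (Z d)) :
    ∑ z ∈ F, ∫ s in Set.Ioi 0, s ^ (α / 2 - 1) * hkH d s (g z) ≤
      (1 / (α / 2) + Real.pi ^ d / ((d : ℝ) / 2 - α / 2)) * (F.card : ℝ) ^ (α / d) := by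
  have ha : 0 < α / 2 := by linarith [hα.1]
  have had : α / 2 < (d : ℝ) / 2 := by linarith [hα.2]
  have hd' : (0 : ℝ) < d := by exact_mod_cast hd
  rcases F.eq_empty_or_nonempty with rfl | hF
  · have : α / d ≠ 0 := (div_pos hα.1 hd').ne'
    simp [Real.zero_rpow this]
  have hN : (0 : ℝ) < F.card := by exact_mod_cast hF.card_pos
  have hint : ∀ z, IntegrableOn (fun s => s ^ (α / 2 - 1) * hkH d s (g z)) (Set.Ioi 0) := fun z =>
    (hk_dom ha had one_pos (fun s => hkH d s (g z)) (hkH_measurable _)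
        (fun s hs => hkH_nonneg hs.le _) (fun s hs => by simpa using hkH_sum_le hs.le {g z})
        (D := Real.pi ^ d) (fun s hs => hkH_le hs _)).1
  rw [← integral_finsetSum _ fun z _ => hint z]
  simp_rw [← Finset.mul_sum]
  have hT : 0 < (F.card : ℝ) ^ (2 / (d : ℝ)) := by positivity
  have h := (hk_dom ha had hT (fun s => ∑ z ∈ F, hkH d s (g z))
    (Finset.aestronglyMeasurable_fun_sum _ fun z _ => hkH_measurable _)
    (fun s hs => Finset.sum_nonneg fun z _ => hkH_nonneg hs.le _)
    (fun s hs => hkH_sum_inj_le hs.le g hg F) (D := F.card * Real.pi ^ d) (fun s hs => by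
      refine (Finset.sum_le_sum fun z _ => hkH_le hs (g z)).trans (le_of_eq ?_)
      rw [Finset.sum_const, nsmul_eq_mul]; ring)).2
  refine h.trans (le_of_eq ?_)
  rw [← Real.rpow_mul hN.le, ← Real.rpow_mul hN.le,
    show 2 / (d : ℝ) * (α / 2) = α / d by field_simp,
    show 2 / (d : ℝ) * (α / 2 - d / 2) = α / d - 1 by field_simp,
    Real.rpow_sub_one hN.ne']
  field_simp

theorem discrete_HLS_inequality
    {d : ℕ} (hd : 0 < d) {α r t : ℝ} (hα : α ∈ Set.Ioo (0 : ℝ) (d : ℝ))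
    (hr : 1 < r) (ht : 1 < t)
    (hrt : 1 / r + 1 / t + ((d : ℝ) - α) / d = 2) :
    ∃ C : ℝ, 0 < C ∧ ∀ u v : Z d → ℝ,
      (Summable fun x : Z d => |u x| ^ r) → (Summable fun x : Z d => |v x| ^ t) →
      (∑' x : Z d, ∑' y : Z d, ENNReal.ofReal (Riesz d α x y * |u y| * |v x|)) ≤
        ENNReal.ofReal (C * lnorm r u * lnorm t v) := by
  have hd' : (0 : ℝ) < d := by exact_mod_cast hd
  have hr0 : 0 < r := by linarith
  have ht0 : 0 < t := by linarith
  have hθ : 0 < α / d := div_pos hα.1 hd'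
  have hrt' : 1 / r + 1 / t = 1 + α / d := by
    rw [sub_div, div_self hd'.ne'] at hrt; linarith
  have htθ : t * (α / d) < 1 := by
    have h1 : 1 / r < 1 := by rw [div_lt_one hr0]; exact hr
    have h2 : α / d < 1 / t := by linarith
    rw [lt_div_iff₀ ht0] at h2; linarith
  have hrθ : r * (α / d) < 1 := by
    have h1 : 1 / t < 1 := by rw [div_lt_one ht0]; exact ht
    have h2 : α / d < 1 / r := by linarith
    rw [lt_div_iff₀ hr0] at h2; linarith
  have hΓ : 0 < Real.Gamma (α / 2) := Real.Gamma_pos_of_pos (by linarith [hα.1])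
  set c : ℝ := Kfrac d α * (Real.Gamma (α / 2))⁻¹ with hc
  have hc0 : 0 ≤ c := mul_nonneg (Kfrac_nonneg d α) (inv_nonneg.2 hΓ.le)
  set c1 : ℝ := 1 / (α / 2) + Real.pi ^ d / ((d : ℝ) / 2 - α / 2) with hc1
  have hc10 : 0 < c1 := by
    have := hα.1
    have : 0 < (d : ℝ) / 2 - α / 2 := by linarith [hα.2]
    positivity
  set c2 : ℝ := 1 / (1 - t * (α / d)) + 1 / (1 - r * (α / d)) with hc2
  have hc20 : 0 < c2 := by
    have : 0 < 1 - t * (α / d) := by linarith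
    have : 0 < 1 - r * (α / d) := by linarith
    positivity
  have hR0 : ∀ x y : Z d, 0 ≤ Riesz d α x y := by
    intro x y
    rw [riesz_eq hd hα]
    refine mul_nonneg hc0 (setIntegral_nonneg measurableSet_Ioi fun s hs => ?_)
    exact mul_nonneg (Real.rpow_nonneg (le_of_lt hs) _) (hkH_nonneg (le_of_lt hs) _)
  have hK : ∀ (y : Z d) (F : Finset (Z d)), ∑ x ∈ F, ENNReal.ofReal (Riesz d α x y) ≤
      ENNReal.ofReal ((c + 1) * c1) * ENNReal.ofReal ((F.card : ℝ) ^ (α / d)) := by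
    intro y F
    rw [← ENNReal.ofReal_sum_of_nonneg fun x _ => hR0 x y, ← ENNReal.ofReal_mul (by positivity)]
    refine ENNReal.ofReal_le_ofReal ?_
    simp_rw [riesz_eq hd hα]
    rw [← Finset.mul_sum, ← hc, mul_assoc (c + 1)]
    refine mul_le_mul (by linarith) (riesz_sum hd hα (fun x => x - y) sub_left_injective F) ?_
      (by positivity)
    refine Finset.sum_nonneg fun x _ => setIntegral_nonneg measurableSet_Ioi fun s hs => ?_
    exact mul_nonneg (Real.rpow_nonneg (le_of_lt hs) _) (hkH_nonneg (le_of_lt hs) _)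
  have hK' : ∀ (x : Z d) (F : Finset (Z d)), ∑ y ∈ F, ENNReal.ofReal (Riesz d α x y) ≤
      ENNReal.ofReal ((c + 1) * c1) * ENNReal.ofReal ((F.card : ℝ) ^ (α / d)) := by
    intro x F
    rw [← ENNReal.ofReal_sum_of_nonneg fun y _ => hR0 x y, ← ENNReal.ofReal_mul (by positivity)]
    refine ENNReal.ofReal_le_ofReal ?_
    simp_rw [riesz_eq hd hα]
    rw [← Finset.mul_sum, ← hc, mul_assoc (c + 1)]
    refine mul_le_mul (by linarith) (riesz_sum hd hα (fun y => x - y) sub_right_injective F) ?_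
      (by positivity)
    refine Finset.sum_nonneg fun x _ => setIntegral_nonneg measurableSet_Ioi fun s hs => ?_
    exact mul_nonneg (Real.rpow_nonneg (le_of_lt hs) _) (hkH_nonneg (le_of_lt hs) _)
  refine ⟨(c + 1) * c1 * c2, by positivity, fun u v hu hv => ?_⟩
  have h := hls_full (fun x y => ENNReal.ofReal (Riesz d α x y)) _ (α / d) hθ hK hK'
    (fun x => |u x|) (fun x => |v x|) (fun x => abs_nonneg _) (fun x => abs_nonneg _) r t hr ht
    hrt' _ _ hu.hasSum hv.hasSum
  have e : ∀ x y : Z d, ENNReal.ofReal (Riesz d α x y * |u y| * |v x|) =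
      ENNReal.ofReal (Riesz d α x y) * ENNReal.ofReal |u y| * ENNReal.ofReal |v x| := by
    intro x y
    rw [ENNReal.ofReal_mul (mul_nonneg (hR0 x y) (abs_nonneg _)), ENNReal.ofReal_mul (hR0 x y)]
  simp_rw [e]
  refine h.trans (le_of_eq ?_)
  rw [← ENNReal.ofReal_mul (by positivity)]
  congr 1
  unfold lnorm
  ring

end DiscreteChoquard
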